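/- arXiv:math/0109202 — 8 statements merged into one kernel-verified Lean document; each statement's English description precedes it below -/
import Mathlib

section
/- Equivariance and time-reversal of the vortex vector field (Proposition 2.1(ii)): Let n ≥ 2, λ : Fin n → ℝ, and let x : Fin n → ℝ³ satisfy ‖x i‖ = 1 for all i and x i ≠ x j for i ≠ j. Let A : ℝ³ → ℝ³ be a linear isometry (element of O(3)) with determinant det A ∈ {1, −1}, let σ be a permutation of Fin n and ε ∈ {1, −1} with λ (σ i) = ε · λ i for all i. Then for every index i, F (fun k => A (x (σ k))) i = (ε · det A) • A (F x (σ i)). In particular, elements with ε · det A = 1 are symmetries of the vector field and elements with ε · det A = −1 are time-reversing symmetries. -/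
open scoped RealInnerProductSpace BigOperators

noncomputable section

/-- Euclidean 3-space. -/
abbrev R3 : Type := EuclideanSpace ℝ (Fin 3)

/-- The vector of `R3` with the given coordinates. -/
def v3 (a b c : ℝ) : R3 := (WithLp.equiv 2 (Fin 3 → ℝ)).symm ![a, b, c]

/-- Cross product on `R3`. -/
def cross (u v : R3) : R3 :=
  v3 (u 1 * v 2 - u 2 * v 1) (u 2 * v 0 - u 0 * v 2) (u 0 * v 1 - u 1 * v 0)

/-- The point-vortex vector field on the sphere:
`F(x) i = Σ_{j ≠ i} (λ j / (1 − ⟪x i, x j⟫)) • (x j × x i)`. -/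
def vortexF {ι : Type} [Fintype ι] [DecidableEq ι] (lam : ι → ℝ) (x : ι → R3) (i : ι) : R3 :=
  ∑ j ∈ Finset.univ.filter (fun j => j ≠ i), (lam j / (1 - ⟪x i, x j⟫)) • cross (x j) (x i)

/-- The point-vortex Hamiltonian `H(y) = Σ_{i<j} λ i λ j log ‖y i − y j‖²`. -/
def vortexH (n : ℕ) (lam : Fin n → ℝ) (y : Fin n → R3) : ℝ :=
  ∑ p ∈ Finset.univ.filter (fun p : Fin n × Fin n => p.1 < p.2),
    lam p.1 * lam p.2 * Real.log (‖y p.1 - y p.2‖ ^ 2)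

/-- The centre of vorticity `Φ(y) = Σ_i λ i • y i`. -/
def vorticityCentre (n : ℕ) (lam : Fin n → ℝ) (y : Fin n → R3) : R3 := ∑ i, lam i • y i

open Module in
/-- The scalar triple product is the determinant in the standard basis. -/
theorem inner_cross_eq_det (w u v : R3) :
    ⟪w, cross u v⟫ = (EuclideanSpace.basisFun (Fin 3) ℝ).toBasis.det ![w, u, v] := by
  rw [Basis.det_apply, Matrix.det_fin_three]
  simp [cross, v3, PiLp.inner_apply, Fin.sum_univ_three, Basis.toMatrix_apply]
  ring

/-- A linear isometry of `R3` commutes with the cross product up to its determinant. -/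
theorem cross_map_linearIsometry (A : R3 →ₗᵢ[ℝ] R3) (u v : R3) :
    cross (A u) (A v) = LinearMap.det A.toLinearMap • A (cross u v) := by
  refine ext_inner_left ℝ fun w => ?_
  obtain ⟨z, rfl⟩ := (LinearMap.injective_iff_surjective (f := A.toLinearMap)).mp A.injective w
  have h := (EuclideanSpace.basisFun (Fin 3) ℝ).toBasis.det_comp A.toLinearMap ![z, u, v]
  have hv : ⇑A.toLinearMap ∘ ![z, u, v] = ![A z, A u, A v] := by
    ext k : 1
    fin_cases k <;> rfl
  rw [hv, ← inner_cross_eq_det, ← inner_cross_eq_det] at h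
  rw [inner_smul_right]
  exact h.trans (congrArg _ (A.inner_map_map z (cross u v)).symm)

/-- equivariance / time-reversal of the vortex vector field
(Proposition 2.1(ii)). -/
theorem vortexF_equivariant (n : ℕ) (hn : 2 ≤ n) (lam : Fin n → ℝ) (x : Fin n → R3)
    (hnorm : ∀ i, ‖x i‖ = 1) (hdist : ∀ i j, i ≠ j → x i ≠ x j)
    (A : R3 →ₗᵢ[ℝ] R3)
    (hdet : LinearMap.det A.toLinearMap = 1 ∨ LinearMap.det A.toLinearMap = -1)
    (σ : Equiv.Perm (Fin n)) (ε : ℝ) (hε : ε = 1 ∨ ε = -1)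
    (hlam : ∀ i, lam (σ i) = ε * lam i) :
    ∀ i, vortexF lam (fun k => A (x (σ k))) i
      = (ε * LinearMap.det A.toLinearMap) • A (vortexF lam x (σ i)) := by
  intro i
  have hε2 : ε * ε = 1 := by rcases hε with rfl | rfl <;> norm_num
  unfold vortexF
  rw [map_sum, Finset.smul_sum]
  refine Finset.sum_equiv σ (by simp) fun j _ => ?_
  rw [A.inner_map_map, cross_map_linearIsometry, map_smul, smul_smul, smul_smul, hlam]
  congr 1
  linear_combination
    -(lam j / (1 - ⟪x (σ i), x (σ j)⟫)) * LinearMap.det A.toLinearMap * hε2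
end
end

section
/- Conservation of the centre of vorticity (Proposition 2.2 / Noether's theorem): Let n ≥ 2 and λ : Fin n → ℝ. Suppose x : ℝ → (Fin n → ℝ³) is such that for every t ∈ ℝ the point x t is a configuration (‖x t i‖ = 1 for all i and x t i ≠ x t j for i ≠ j) and for every i and t the curve s ↦ x s i has derivative F (x t) i at t (HasDerivAt). Then Φ (x t) = Φ (x 0) for all t ∈ ℝ. -/
open scoped RealInnerProductSpace BigOperators

noncomputable section

theorem cross_eq_neg_cross (u v : R3) : cross u v = -cross v u := by
  ext k
  fin_cases k <;> simp [cross, v3] <;> ring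

/-- The vorticity-weighted sum of the point-vortex field vanishes, since the pairwise
interactions are antisymmetric. -/
theorem sum_smul_vortexF_eq_zero {ι : Type} [Fintype ι] [DecidableEq ι] (lam : ι → ℝ)
    (x : ι → R3) : ∑ i, lam i • vortexF lam x i = 0 := by
  have := IsAddTorsionFree.of_module_rat R3
  refine self_eq_neg.mp ?_
  simp only [vortexF, Finset.sum_filter, Finset.smul_sum]
  conv_lhs => rw [Finset.sum_comm]
  simp only [← Finset.sum_neg_distrib]
  refine Finset.sum_congr rfl fun i _ => Finset.sum_congr rfl fun j _ => ?_
  by_cases h : i = j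
  · simp [h]
  · rw [if_pos h, if_pos (Ne.symm h), cross_eq_neg_cross (x i), real_inner_comm, smul_neg, smul_neg,
      smul_smul, smul_smul]
    congr 2
    ring

/-- conservation of the centre of vorticity along solutions of the
point-vortex equations (Proposition 2.2, Noether's theorem). -/
theorem centre_of_vorticity_conserved (n : ℕ) (hn : 2 ≤ n) (lam : Fin n → ℝ)
    (x : ℝ → Fin n → R3)
    (hnorm : ∀ t, ∀ i, ‖x t i‖ = 1)
    (hdist : ∀ t, ∀ i j, i ≠ j → x t i ≠ x t j)
    (hflow : ∀ i, ∀ t : ℝ, HasDerivAt (fun s => x s i) (vortexF lam (x t) i) t) :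
    ∀ t : ℝ, vorticityCentre n lam (x t) = vorticityCentre n lam (x 0) := by
  have hderiv (t : ℝ) : HasDerivAt (fun s => vorticityCentre n lam (x s)) 0 t := by
    rw [← sum_smul_vortexF_eq_zero lam (x t)]
    exact HasDerivAt.fun_sum fun i _ => (hflow i t).const_smul (lam i)
  exact fun t => is_const_of_deriv_eq_zero (fun t => (hderiv t).differentiableAt)
    (fun t => (hderiv t).deriv) t 0
end
end

section
/- Isolated symmetric points are fixed equilibria (Theorem 3.1, Michel/Palais principle of symmetric criticality): Let n ≥ 2 and λ : Fin n → ℝ. Let M be the set of configurations, i.e. of y : Fin n → ℝ³ with ‖y i‖ = 1 for all i and y i ≠ y j for i ≠ j. Let Γ be a collection of pairs (A, σ) with A a linear isometry of ℝ³ and σ a permutation of Fin n, such that Γ contains the identity, is closed under the composition (A, σ) · (B, ρ) = (A ∘ B, ρ ∘ σ) and under inverses, and such that every (A, σ) ∈ Γ satisfies λ ∘ σ = λ or λ ∘ σ = −λ. Let Fix(Γ) = { y ∈ M | ∀ (A, σ) ∈ Γ, ∀ i, A (y (σ i)) = y i }. If x ∈ Fix(Γ) and x is an isolated point of Fix(Γ)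 (i.e. there is an open neighbourhood U of x in Fin n → ℝ³ with Fix(Γ) ∩ U = {x}), then x is a critical point of H on M: for every v : Fin n → ℝ³ with ⟪v i, x i⟫ = 0 for all i, fderiv ℝ H x v = 0. -/
open scoped RealInnerProductSpace BigOperators

noncomputable section

/-- The fixed point set of a collection `Γ` of symmetries inside the configuration space. -/
def fixSet (n : ℕ) (Γ : Set ((R3 ≃ₗᵢ[ℝ] R3) × Equiv.Perm (Fin n))) : Set (Fin n → R3) :=
  { y | (∀ i, ‖y i‖ = 1) ∧ (∀ i j, i ≠ j → y i ≠ y j) ∧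
        ∀ p ∈ Γ, ∀ i, p.1 (y (p.2 i)) = y i }

open Filter Topology

/-- The action `(A, σ) • y = (A (y (σ i)))ᵢ` as a continuous linear equivalence. -/
def symmetryEquiv (n : ℕ) (p : (R3 ≃ₗᵢ[ℝ] R3) × Equiv.Perm (Fin n)) :
    (Fin n → R3) ≃L[ℝ] (Fin n → R3) :=
  ((LinearEquiv.funCongrLeft ℝ R3 p.2).trans
    (LinearEquiv.piCongrRight fun _ => p.1.toLinearEquiv)).toContinuousLinearEquiv

@[simp]
lemma symmetryEquiv_apply (n : ℕ) (p : (R3 ≃ₗᵢ[ℝ] R3) × Equiv.Perm (Fin n))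
    (y : Fin n → R3) (i : Fin n) : symmetryEquiv n p y i = p.1 (y (p.2 i)) := rfl

/-- The Hamiltonian as a sum over all ordered pairs; the diagonal terms vanish as `log 0 = 0`. -/
lemma two_mul_vortexH (n : ℕ) (lam : Fin n → ℝ) (y : Fin n → R3) :
    2 * vortexH n lam y = ∑ i, ∑ j, lam i * lam j * Real.log (‖y i - y j‖ ^ 2) := by
  have hlt : vortexH n lam y =
      ∑ i, ∑ j, if i < j then lam i * lam j * Real.log (‖y i - y j‖ ^ 2) else 0 := by
    rw [vortexH, Finset.sum_filter, Fintype.sum_prod_type]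
  have hgt : vortexH n lam y =
      ∑ i, ∑ j, if j < i then lam i * lam j * Real.log (‖y i - y j‖ ^ 2) else 0 := by
    rw [hlt, Finset.sum_comm]
    simp only [norm_sub_rev, mul_comm]
  rw [two_mul]
  nth_rewrite 1 [hlt]
  rw [hgt, ← Finset.sum_add_distrib]
  refine Finset.sum_congr rfl fun i _ => ?_
  rw [← Finset.sum_add_distrib]
  refine Finset.sum_congr rfl fun j _ => ?_
  rcases lt_trichotomy i j with h | h | h
  · simp [h, h.not_gt]
  · simp [h]
  · simp [h, h.not_gt]

lemma vortexH_symmetryEquiv (n : ℕ) (lam : Fin n → ℝ)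
    (p : (R3 ≃ₗᵢ[ℝ] R3) × Equiv.Perm (Fin n))
    (hp : (fun i => lam (p.2 i)) = lam ∨ (fun i => lam (p.2 i)) = fun i => -lam i)
    (y : Fin n → R3) : vortexH n lam (symmetryEquiv n p y) = vortexH n lam y := by
  have hlam (i j) : lam (p.2 i) * lam (p.2 j) = lam i * lam j := by
    rcases hp with h | h
    · rw [congrFun h i, congrFun h j]
    · rw [congrFun h i, congrFun h j, neg_mul_neg]
  refine mul_left_cancel₀ (two_ne_zero (α := ℝ)) ?_
  rw [two_mul_vortexH, two_mul_vortexH]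
  symm
  rw [← Equiv.sum_comp p.2]
  refine Finset.sum_congr rfl fun i _ => ?_
  rw [← Equiv.sum_comp p.2]
  refine Finset.sum_congr rfl fun j _ => ?_
  rw [symmetryEquiv_apply, symmetryEquiv_apply, ← map_sub, LinearIsometryEquiv.norm_map, hlam]

/-- The differential of an invariant function at a fixed point is invariant. -/
lemma fderiv_symmetryEquiv_of_invariant (n : ℕ) (f : (Fin n → R3) → ℝ)
    (p : (R3 ≃ₗᵢ[ℝ] R3) × Equiv.Perm (Fin n)) (hf : ∀ y, f (symmetryEquiv n p y) = f y)
    (x : Fin n → R3) (hx : symmetryEquiv n p x = x) (v : Fin n → R3) :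
    fderiv ℝ f x (symmetryEquiv n p v) = fderiv ℝ f x v := by
  have h := (symmetryEquiv n p).comp_right_fderiv (f := f) (x := x)
  rw [show f ∘ symmetryEquiv n p = f from funext hf, hx] at h
  exact (DFunLike.congr_fun h v).symm

/-- The vector of `i`-th partial gradients representing a functional on configurations. -/
def dualVector (n : ℕ) (L : (Fin n → R3) →L[ℝ] ℝ) (i : Fin n) : R3 :=
  (InnerProductSpace.toDual ℝ R3).symm (L.comp (ContinuousLinearMap.single ℝ (fun _ => R3) i))

lemma inner_dualVector (n : ℕ) (L : (Fin n → R3) →L[ℝ] ℝ) (i : Fin n) (w : R3) :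
    ⟪dualVector n L i, w⟫ = L (Pi.single i w) := by
  simp [dualVector]

lemma sum_inner_dualVector (n : ℕ) (L : (Fin n → R3) →L[ℝ] ℝ) (v : Fin n → R3) :
    ∑ i, ⟪dualVector n L i, v i⟫ = L v := by
  simp only [inner_dualVector, ← map_sum, Finset.univ_sum_single]

lemma symmetryEquiv_dualVector (n : ℕ) (L : (Fin n → R3) →L[ℝ] ℝ)
    (p : (R3 ≃ₗᵢ[ℝ] R3) × Equiv.Perm (Fin n)) (hL : ∀ v, L (symmetryEquiv n p v) = L v)
    (i : Fin n) : p.1 (dualVector n L (p.2 i)) = dualVector n L i := by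
  refine ext_inner_right ℝ fun w => ?_
  have hsingle : symmetryEquiv n p (Pi.single (p.2 i) (p.1.symm w)) = Pi.single i w := by
    ext1 k
    rcases eq_or_ne k i with rfl | hk
    · simp
    · simp [hk]
  rw [inner_dualVector, ← hsingle, hL, ← inner_dualVector,
    ← p.1.inner_map_map (dualVector n L (p.2 i)), p.1.apply_symm_apply]

/-- A tangent vector which is fixed by `Γ` vanishes at an isolated point of the fixed point set:
otherwise the normalized line in its direction would stay in the fixed point set. -/
lemma eq_zero_of_isolated_of_fixed (n : ℕ) (Γ : Set ((R3 ≃ₗᵢ[ℝ] R3) × Equiv.Perm (Fin n)))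
    (x : Fin n → R3) (hx : x ∈ fixSet n Γ)
    (hisol : ∃ U : Set (Fin n → R3), IsOpen U ∧ x ∈ U ∧ fixSet n Γ ∩ U = {x})
    (g : Fin n → R3) (hg : ∀ i, ⟪g i, x i⟫ = 0)
    (hfix : ∀ p ∈ Γ, ∀ i, p.1 (g (p.2 i)) = g i) : g = 0 := by
  obtain ⟨hnorm, hne, hxfix⟩ := hx
  obtain ⟨U, hU, hxU, hUfix⟩ := hisol
  have hpos (t : ℝ) (i : Fin n) : ‖x i + t • g i‖ ≠ 0 := by
    rw [norm_ne_zero_iff]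
    intro h
    have h1 : ⟪x i + t • g i, x i⟫ = 1 := by
      rw [inner_add_left, inner_smul_left, hg, real_inner_self_eq_norm_sq, hnorm]
      simp
    rw [h, inner_zero_left] at h1
    exact zero_ne_one h1
  let c : ℝ → Fin n → R3 := fun t i => ‖x i + t • g i‖⁻¹ • (x i + t • g i)
  have hc0 : c 0 = x := by
    ext1 i
    simp [c, hnorm]
  have hc : Continuous c := by
    refine continuous_pi fun i => Continuous.smul (Continuous.inv₀ ?_ fun t => hpos t i) ?_ <;>
      fun_prop
  have hev : ∀ᶠ t in 𝓝 (0 : ℝ), c t ∈ U ∧ ∀ i j, i ≠ j → c t i ≠ c t j := by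
    refine (hc.continuousAt.eventually_mem (hU.mem_nhds (hc0.symm ▸ hxU))).and ?_
    refine eventually_all.2 fun i => eventually_all.2 fun j => eventually_imp_distrib_left.2 ?_
    intro hij
    refine (hc.continuousAt.eventually (p := fun y => y i ≠ y j) ?_)
    rw [hc0]
    exact ((continuous_apply i).continuousAt.ne_iff_eventually_ne
      (continuous_apply j).continuousAt).1 (hne i j hij)
  obtain ⟨t, ⟨htU, htne⟩, ht⟩ :=
    ((hev.filter_mono nhdsWithin_le_nhds).and (self_mem_nhdsWithin (s := {(0 : ℝ)}ᶜ))).exists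
  have htfix : c t ∈ fixSet n Γ := by
    refine ⟨fun i => ?_, htne, fun p hp i => ?_⟩
    · rw [norm_smul, norm_inv, norm_norm, inv_mul_cancel₀ (hpos t i)]
    · have hline : p.1 (x (p.2 i) + t • g (p.2 i)) = x i + t • g i := by
        rw [map_add, map_smul, hxfix p hp, hfix p hp]
      have hlen := p.1.norm_map (x (p.2 i) + t • g (p.2 i))
      rw [hline] at hlen
      simp only [c]
      rw [map_smul, hline, hlen]
  have htx : c t = x := by
    have : c t ∈ fixSet n Γ ∩ U := ⟨htfix, htU⟩
    rwa [hUfix] at this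
  ext1 i
  have h : ⟪g i, c t i⟫ = 0 := by rw [htx, hg]
  simp only [c, inner_smul_right, inner_add_right, hg, zero_add, mul_eq_zero, inv_eq_zero] at h
  simpa using (h.resolve_left (hpos t i)).resolve_left ht

/-- an isolated point of the fixed point set of a group of symmetries of the
Hamiltonian is a fixed equilibrium, i.e. a critical point of `H` on the configuration
manifold (Theorem 3.1, principle of symmetric criticality). -/
theorem isolated_fixed_point_is_equilibrium (n : ℕ) (hn : 2 ≤ n) (lam : Fin n → ℝ)
    (Γ : Set ((R3 ≃ₗᵢ[ℝ] R3) × Equiv.Perm (Fin n)))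
    (hid : (LinearIsometryEquiv.refl ℝ R3, (1 : Equiv.Perm (Fin n))) ∈ Γ)
    (hmul : ∀ p ∈ Γ, ∀ q ∈ Γ,
      ((Prod.fst q).trans (Prod.fst p), (Prod.snd q) * (Prod.snd p)) ∈ Γ)
    (hinv : ∀ p ∈ Γ, ((Prod.fst p).symm, (Prod.snd p)⁻¹) ∈ Γ)
    (hlamΓ : ∀ p ∈ Γ, ((fun i => lam (Prod.snd p i)) = lam ∨ (fun i => lam (Prod.snd p i)) = fun i => -lam i))
    (x : Fin n → R3) (hx : x ∈ fixSet n Γ)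
    (hisol : ∃ U : Set (Fin n → R3), IsOpen U ∧ x ∈ U ∧ fixSet n Γ ∩ U = {x}) :
    ∀ v : Fin n → R3, (∀ i, ⟪v i, x i⟫ = 0) → fderiv ℝ (vortexH n lam) x v = 0 := by
  intro v hv
  let G := dualVector n (fderiv ℝ (vortexH n lam) x)
  have hG (p) (hp : p ∈ Γ) (i) : p.1 (G (p.2 i)) = G i :=
    symmetryEquiv_dualVector n _ p (fderiv_symmetryEquiv_of_invariant n _ p
      (vortexH_symmetryEquiv n lam p (hlamΓ p hp)) x (funext (hx.2.2 p hp))) i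
  have hzero : (fun i => G i - ⟪G i, x i⟫ • x i) = 0 := by
    refine eq_zero_of_isolated_of_fixed n Γ x hx hisol _ (fun i => ?_) fun p hp i => ?_
    · rw [inner_sub_left, real_inner_smul_left, real_inner_self_eq_norm_sq, hx.1]
      ring
    · rw [map_sub, map_smul, ← p.1.inner_map_map, hG p hp, hx.2.2 p hp]
  rw [← sum_inner_dualVector]
  refine Finset.sum_eq_zero fun i _ => ?_
  change ⟪G i, v i⟫ = 0
  rw [sub_eq_zero.1 (congrFun hzero i), real_inner_smul_left, real_inner_comm (v i), hv, mul_zero]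
end
end

section
/- Necessary condition for fixed equilibria (Kidambi–Newton condition, as used in Section 3.1): Let n ≥ 2, λ : Fin n → ℝ, and let x : Fin n → ℝ³ satisfy ‖x i‖ = 1 for all i and x i ≠ x j for i ≠ j. If x is a fixed equilibrium, i.e. F(x) i = 0 for all i, then Σ_i (λ i − Λ) · λ i • x i = 0, where Λ = Σ_j λ j. In particular, if n = 2N with λ i ∈ {1, −1} and Σ_i λ i = 0, then Σ_i x i = 0: the centre of the sphere is the isobarycentre of the configuration. -/
open scoped RealInnerProductSpace BigOperators

noncomputable section

theorem inner_eq_sum_coords (u v : R3) : ⟪u, v⟫ = u 0 * v 0 + u 1 * v 1 + u 2 * v 2 := by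
  simp [PiLp.inner_apply, Fin.sum_univ_three, mul_comm]

/-- The cross product with a fixed left factor, as a linear map. -/
def crossLeft (u : R3) : R3 →ₗ[ℝ] R3 where
  toFun := cross u
  map_add' v w := by
    ext k
    fin_cases k <;> simp [cross, v3] <;> ring
  map_smul' c v := by
    ext k
    fin_cases k <;> simp [cross, v3] <;> ring

theorem crossLeft_cross (u v : R3) : crossLeft u (cross v u) = ⟪u, u⟫ • v - ⟪u, v⟫ • u := by
  rw [inner_eq_sum_coords, inner_eq_sum_coords]
  ext k
  fin_cases k <;> simp [crossLeft, cross, v3] <;> ring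

theorem crossLeft_vortexF {ι : Type} [Fintype ι] [DecidableEq ι] (lam : ι → ℝ) (x : ι → R3)
    (hnorm : ∀ i, ‖x i‖ = 1) (hdist : ∀ i j, i ≠ j → x i ≠ x j) (i : ι) :
    crossLeft (x i) (vortexF lam x i) =
      ∑ j, (lam j / (1 - ⟪x i, x j⟫)) • (x j - x i) - (lam i - ∑ j, lam j) • x i := by
  have hterm : ∀ j ∈ Finset.univ.filter (fun j => j ≠ i),
      (lam j / (1 - ⟪x i, x j⟫)) • crossLeft (x i) (cross (x j) (x i)) =
        (lam j / (1 - ⟪x i, x j⟫)) • (x j - x i) + lam j • x i := by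
    intro j hj
    have hne : 1 - ⟪x i, x j⟫ ≠ 0 := fun h =>
      hdist i j (Finset.mem_filter.mp hj).2.symm
        ((inner_eq_one_iff_of_norm_eq_one (𝕜 := ℝ) (hnorm i) (hnorm j)).mp (by linarith))
    have hself : ⟪x i, x i⟫ = 1 := by simp [hnorm i]
    rw [crossLeft_cross, hself]
    match_scalars <;> field_simp
    ring
  have hlam : ∑ j ∈ Finset.univ.filter (fun j => j ≠ i), lam j = ∑ j, lam j - lam i := by
    rw [Finset.filter_ne', ← Finset.add_sum_erase _ lam (Finset.mem_univ i)]
    ring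
  have hdiff : ∑ j ∈ Finset.univ.filter (fun j => j ≠ i),
      (lam j / (1 - ⟪x i, x j⟫)) • (x j - x i) =
        ∑ j, (lam j / (1 - ⟪x i, x j⟫)) • (x j - x i) := by
    refine Finset.sum_subset (Finset.filter_subset _ _) fun j _ hj => ?_
    obtain rfl : j = i := by simpa using hj
    simp
  simp only [vortexF, map_sum, map_smul]
  rw [Finset.sum_congr rfl hterm, Finset.sum_add_distrib, ← Finset.sum_smul, hlam, hdiff]
  module

theorem sum_sum_smul_sub_eq_zero {ι E : Type*} [Fintype ι] [AddCommGroup E] [Module ℝ E]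
    (a : ι → ι → ℝ) (ha : ∀ i j, a i j = a j i) (x : ι → E) :
    ∑ i, ∑ j, a i j • (x j - x i) = 0 := by
  simp only [smul_sub, Finset.sum_sub_distrib]
  rw [sub_eq_zero, Finset.sum_comm]
  simp only [ha]

/-- the Kidambi–Newton necessary condition for fixed equilibria,
`Σ_i (λ i − Λ) λ i • x i = 0` with `Λ = Σ_j λ j`; in particular for `2N` vortices of
vorticities `±1` summing to zero, the centre of the sphere is the isobarycentre. -/
theorem fixed_equilibrium_necessary_condition (n : ℕ) (hn : 2 ≤ n) (lam : Fin n → ℝ)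
    (x : Fin n → R3)
    (hnorm : ∀ i, ‖x i‖ = 1) (hdist : ∀ i j, i ≠ j → x i ≠ x j)
    (heq : ∀ i, vortexF lam x i = 0) :
    (∑ i, ((lam i - ∑ j, lam j) * lam i) • x i = 0) ∧
    (∀ N : ℕ, n = 2 * N → (∀ i, lam i = 1 ∨ lam i = -1) → (∑ i, lam i) = 0 →
      ∑ i, x i = 0) := by
  have hmain : ∑ i, ((lam i - ∑ j, lam j) * lam i) • x i = 0 := by
    rw [← sum_sum_smul_sub_eq_zero (fun i j => lam i * (lam j / (1 - ⟪x i, x j⟫)))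
      (fun i j => by rw [real_inner_comm]; ring) x]
    refine Finset.sum_congr rfl fun i _ => ?_
    have h := crossLeft_vortexF lam x hnorm hdist i
    rw [heq i, map_zero, eq_comm, sub_eq_zero] at h
    simp only [mul_smul]
    rw [← Finset.smul_sum, h, smul_comm]
  refine ⟨hmain, fun N _ hsign hsum => ?_⟩
  rw [← hmain]
  refine Finset.sum_congr rfl fun i _ => ?_
  rcases hsign i with h | h <;> simp [hsum, h]
end
end

section
/- The equatorial alternating ring D_{2Nh}(R_e) is a fixed equilibrium (Proposition 3.2, first part): Let N ≥ 1, n = 2N, and define the configuration x : Fin (2N) → ℝ³ by x j = (cos (j·π/N), sin (j·π/N), 0) with vorticities λ j = (−1)^j for j = 0, …, 2N−1. Then F(x) i = 0 for every i. -/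
open scoped RealInnerProductSpace BigOperators

noncomputable section

/-- The unit vector at longitude `θ` on the equator. -/
def equatorPoint (θ : ℝ) : R3 := v3 (Real.cos θ) (Real.sin θ) 0

lemma equatorPoint_add_int_mul_two_pi (θ : ℝ) (k : ℤ) :
    equatorPoint (θ + k * (2 * Real.pi)) = equatorPoint θ := by
  simp only [equatorPoint, Real.cos_add_int_mul_two_pi, Real.sin_add_int_mul_two_pi]

lemma inner_equatorPoint (α β : ℝ) :
    ⟪equatorPoint α, equatorPoint β⟫ = Real.cos (β - α) := by
  simp [equatorPoint, v3, PiLp.inner_apply, Fin.sum_univ_three, Real.cos_sub]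

lemma cross_equatorPoint (α β : ℝ) :
    cross (equatorPoint α) (equatorPoint β) = Real.sin (β - α) • v3 0 0 1 := by
  ext k
  fin_cases k <;> simp [equatorPoint, cross, v3, Real.sin_sub]
  ring

/-- Equatorial vortices that are symmetric, with their vorticities, under the reflection through
the meridian of the `i`-th vortex induce no velocity at that vortex. -/
lemma vortexF_equatorPoint_eq_zero_of_reflection {ι : Type} [Fintype ι] [DecidableEq ι]
    (lam : ι → ℝ) (θ : ι → ℝ) (i : ι) (σ : Equiv.Perm ι) (hσi : σ i = i)
    (hlam : ∀ j, lam (σ j) = lam j)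
    (hσ : ∀ j, equatorPoint (θ (σ j)) = equatorPoint (2 * θ i - θ j)) :
    vortexF lam (fun j => equatorPoint (θ j)) i = 0 := by
  have : IsAddTorsionFree R3 := .of_module_rat R3
  refine self_eq_neg.mp ?_
  unfold vortexF
  rw [← Finset.sum_neg_distrib]
  refine (Finset.sum_equiv σ (fun j => ?_) fun j _ => ?_).symm
  · simp [← σ.injective.ne_iff (x := j) (y := i), hσi]
  · simp only [hlam, hσ, inner_equatorPoint, cross_equatorPoint]
    rw [show θ i - (2 * θ i - θ j) = -(θ i - θ j) by ring,
      show 2 * θ i - θ j - θ i = -(θ j - θ i) by ring, Real.sin_neg, Real.cos_neg, neg_smul,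
      smul_neg]

lemma Fin.exists_val_add_self_sub_eq {n : ℕ} [NeZero n] (i j : Fin n) :
    ∃ k : ℤ, (((i + i - j : Fin n) : ℕ) : ℤ) = 2 * (i : ℕ) - (j : ℕ) + k * n := by
  have h : (((i + i - j : Fin n) : ℕ) : ℤ) ≡ 2 * (i : ℕ) - (j : ℕ) [ZMOD n] := by
    have hj : (i + i - j) + j = i + i := sub_add_cancel _ _
    have hv := congrArg Fin.val hj
    rw [Fin.val_add, Fin.val_add i i] at hv
    have hm : (((i + i - j : Fin n) : ℕ) + (j : ℕ) : ℤ) ≡ (i : ℕ) + (i : ℕ) [ZMOD n] := by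
      exact_mod_cast (Int.natCast_modEq_iff.mpr hv)
    simpa [two_mul] using hm.sub_right ((j : ℕ) : ℤ)
  obtain ⟨k, hk⟩ := h.symm.dvd
  exact ⟨k, by linarith⟩

/-- the equatorial alternating ring `D_{2Nh}(R_e)` is a fixed equilibrium
(Proposition 3.2, first part). -/
theorem equatorial_alternating_ring_fixed_equilibrium (N : ℕ) (hN : 1 ≤ N)
    (x : Fin (2 * N) → R3) (lam : Fin (2 * N) → ℝ)
    (hx : ∀ j : Fin (2 * N),
      x j = v3 (Real.cos (((j : ℕ) : ℝ) * Real.pi / (N : ℝ)))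
               (Real.sin (((j : ℕ) : ℝ) * Real.pi / (N : ℝ))) 0)
    (hlam : ∀ j : Fin (2 * N), lam j = (-1 : ℝ) ^ ((j : ℕ))) :
    ∀ i, vortexF lam x i = 0 := by
  have : NeZero (2 * N) := ⟨by omega⟩
  have hN0 : (N : ℝ) ≠ 0 := by exact_mod_cast (by omega : N ≠ 0)
  intro i
  rw [show x = fun j : Fin (2 * N) => equatorPoint (((j : ℕ) : ℝ) * Real.pi / (N : ℝ))
    from funext hx]
  refine vortexF_equatorPoint_eq_zero_of_reflection lam _ i (Equiv.subLeft (i + i))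
    (add_sub_cancel_right i i) (fun j => ?_) (fun j => ?_)
  · obtain ⟨k, hk⟩ := Fin.exists_val_add_self_sub_eq i j
    rw [hlam, hlam, Equiv.subLeft_apply, neg_one_pow_eq_pow_mod_two,
      neg_one_pow_eq_pow_mod_two (n := (j : ℕ))]
    congr 1
    have hpar : k * ((2 * N : ℕ) : ℤ) = 2 * (k * N) := by push_cast; ring
    omega
  · obtain ⟨k, hk⟩ := Fin.exists_val_add_self_sub_eq i j
    have hk' : (((i + i - j : Fin (2 * N)) : ℕ) : ℝ) =
        2 * (i : ℕ) - (j : ℕ) + k * (2 * N) := by exact_mod_cast hk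
    rw [Equiv.subLeft_apply, hk', ← equatorPoint_add_int_mul_two_pi (_ - _) k]
    congr 1
    field_simp
end
end

section
/- A regular tetrahedron together with its dual tetrahedron is a fixed equilibrium (Proposition 3.2, second part, with the remark that the two vorticity strengths may be arbitrary): Let s = 1/√3 and t₀ = s·(1,1,1), t₁ = s·(1,−1,−1), t₂ = s·(−1,1,−1), t₃ = s·(−1,−1,1) in ℝ³. Let a, b ∈ ℝ and consider the configuration of n = 8 vortices whose positions are t₀, t₁, t₂, t₃ with vorticity a each, and −t₀, −t₁, −t₂, −t₃ with vorticity b each. Then F(x) i = 0 for every i. -/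
open scoped RealInnerProductSpace BigOperators

noncomputable section

theorem inner_v3 (a b c d e f : ℝ) : ⟪v3 a b c, v3 d e f⟫ = a * d + b * e + c * f := by
  simp [v3, PiLp.inner_apply, Fin.sum_univ_three]
  ring

theorem neg_v3 (a b c : ℝ) : -v3 a b c = v3 (-a) (-b) (-c) := by
  ext k
  fin_cases k <;> simp [v3]

theorem cross_v3 (a b c d e f : ℝ) :
    cross (v3 a b c) (v3 d e f) = v3 (b * f - c * e) (c * d - a * f) (a * e - b * d) := by
  simp [cross, v3]

theorem smul_v3 (r a b c : ℝ) : r • v3 a b c = v3 (r * a) (r * b) (r * c) := by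
  ext k
  fin_cases k <;> simp [v3]

theorem add_v3 (a b c d e f : ℝ) : v3 a b c + v3 d e f = v3 (a + d) (b + e) (c + f) := by
  ext k
  fin_cases k <;> simp [v3]

theorem v3_zero : v3 0 0 0 = 0 := by
  ext k
  fin_cases k <;> simp [v3]

/-- a regular tetrahedron of vortices of strength `a` together with its dual
tetrahedron of vortices of strength `b` is a fixed equilibrium (Proposition 3.2, second
part, with arbitrary strengths `a`, `b`). -/
theorem tetrahedron_and_dual_fixed_equilibrium (a b : ℝ)
    (t0 t1 t2 t3 : R3)
    (ht0 : t0 = v3 (1 / Real.sqrt 3) (1 / Real.sqrt 3) (1 / Real.sqrt 3))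
    (ht1 : t1 = v3 (1 / Real.sqrt 3) (-(1 / Real.sqrt 3)) (-(1 / Real.sqrt 3)))
    (ht2 : t2 = v3 (-(1 / Real.sqrt 3)) (1 / Real.sqrt 3) (-(1 / Real.sqrt 3)))
    (ht3 : t3 = v3 (-(1 / Real.sqrt 3)) (-(1 / Real.sqrt 3)) (1 / Real.sqrt 3))
    (x : Fin 8 → R3) (hx : x = ![t0, t1, t2, t3, -t0, -t1, -t2, -t3])
    (lam : Fin 8 → ℝ) (hlam : lam = ![a, a, a, a, b, b, b, b]) :
    ∀ i, vortexF lam x i = 0 := by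
  have hs : 1 / Real.sqrt 3 * (1 / Real.sqrt 3) = 1 / 3 := by
    rw [div_mul_div_comm, Real.mul_self_sqrt (by norm_num)]
    norm_num
  generalize 1 / Real.sqrt 3 = s at *
  subst ht0 ht1 ht2 ht3 hx hlam
  intro i
  rw [vortexF, Finset.sum_filter, ← v3_zero]
  fin_cases i <;>
    simp [Fin.sum_univ_eight, neg_v3, inner_v3, cross_v3, smul_v3, add_v3, hs] <;>
    norm_num
end
end

section
/- The C_{2v}(2R,2p) branch of six-vortex relative equilibria (Section 3.2.2, first family, aligned rings): Let λ_n ∈ ℝ and x, y ∈ (−1, 1) with x ≠ y. Consider the configuration of 6 vortices with positions P₁ = (√(1−x²), 0, x), P₂ = (−√(1−x²), 0, x) of vorticity +1, P₃ = (√(1−y²), 0, y), P₄ = (−√(1−y²), 0, y) of vorticity −1, the North pole (0,0,1) of vorticity λ_n and the South pole (0,0,−1) of vorticity −λ_n. Then there exists ξ ∈ ℝ with F(p) i = ξ • ((0,0,1) × p i) for all six vortices p i (i.e. the configuration is a relative equilibrium rotating about the z-axis) if and only if (y + x) · ( x·y − 1 + 2·λ_n·(y − x) ) = 0. -/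
open scoped RealInnerProductSpace BigOperators

noncomputable section

lemma vortexF_term_meridian (k a c b d : ℝ) :
    (k / (1 - ⟪v3 a 0 c, v3 b 0 d⟫)) • cross (v3 b 0 d) (v3 a 0 c) =
      v3 0 (k / (1 - (a * b + c * d)) * (d * a - b * c)) 0 := by
  have h : ⟪v3 a 0 c, v3 b 0 d⟫ = a * b + c * d := by
    simp [v3, PiLp.inner_apply, Fin.sum_univ_three, mul_comm]
  rw [h]
  ext i
  fin_cases i <;> simp [v3, cross]

lemma smul_cross_axis_meridian (ξ a c : ℝ) :
    ξ • cross (v3 0 0 1) (v3 a 0 c) = v3 0 (ξ * a) 0 := by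
  ext i
  fin_cases i <;> simp [v3, cross]

lemma v3_axis_inj (a b : ℝ) : v3 0 a 0 = v3 0 b 0 ↔ a = b :=
  ⟨fun h => by simpa [v3] using congrArg (fun u : R3 => u 1) h, fun h => by rw [h]⟩

/-- Vortices on a common meridian circle move perpendicularly to its plane. -/
lemma vortexF_meridian {ι : Type} [Fintype ι] [DecidableEq ι] (lam a c : ι → ℝ) (i : ι) :
    vortexF lam (fun j => v3 (a j) 0 (c j)) i =
      v3 0 (∑ j ∈ Finset.univ.filter (fun j => j ≠ i),
        lam j / (1 - (a i * a j + c i * c j)) * (c j * a i - a j * c i)) 0 := by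
  simp only [vortexF, vortexF_term_meridian]
  ext k
  fin_cases k <;> simp [v3]

/-- Joint contribution of an antipodal pair on the parallel of height `y`, radius `s`, to the
velocity of a vortex at height `x`, radius `r`, on the same meridian. -/
lemma ring_pair_contribution (k r s x y : ℝ) (hr : r ^ 2 = 1 - x ^ 2) (hs : s ^ 2 = 1 - y ^ 2)
    (hxy : x ≠ y) :
    k / (1 - (r * s + x * y)) * (y * r - s * x) +
      k / (1 - (r * -s + x * y)) * (y * r - -s * x) = k * (2 * r / (y - x)) := by
  have hprod : (1 - (r * s + x * y)) * (1 - (r * -s + x * y)) = (y - x) ^ 2 := by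
    linear_combination (-s ^ 2) * hr - (1 - x ^ 2) * hs
  have hyx : y - x ≠ 0 := sub_ne_zero.mpr hxy.symm
  have hne : (1 - (r * s + x * y)) * (1 - (r * -s + x * y)) ≠ 0 := by
    rw [hprod]; exact pow_ne_zero 2 hyx
  have h₁ := left_ne_zero_of_mul hne
  have h₂ := right_ne_zero_of_mul hne
  have key : k / (1 - (r * s + x * y)) * (y * r - s * x) +
      k / (1 - (r * -s + x * y)) * (y * r - -s * x) =
      k * (2 * r * (y - x)) / ((1 - (r * s + x * y)) * (1 - (r * -s + x * y))) := by
    rw [div_mul_eq_mul_div, div_mul_eq_mul_div, div_add_div _ _ h₁ h₂]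
    congr 1
    linear_combination (-2 * k * r * x) * hs
  rw [key, hprod]
  field_simp

lemma antipode_contribution (k r x : ℝ) (hr : r ^ 2 = 1 - x ^ 2) (hr0 : r ≠ 0) :
    k / (1 - (r * -r + x * x)) * (x * r - -r * x) = k * (x / (1 - x ^ 2) * r) := by
  have h : 1 - (r * -r + x * x) = 2 * r ^ 2 := by linear_combination -hr
  rw [h, ← hr]
  field_simp
  ring

lemma poles_contribution (k r x : ℝ) (hx : x ∈ Set.Ioo (-1 : ℝ) 1) :
    k / (1 - (r * 0 + x * 1)) * (1 * r - 0 * x) +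
      -k / (1 - (r * 0 + x * -1)) * (-1 * r - 0 * x) = 2 * k / (1 - x ^ 2) * r := by
  have h₁ : 1 - x ≠ 0 := by linarith [hx.2]
  have h₂ : 1 + x ≠ 0 := by linarith [hx.1]
  have h₃ : 1 - x ^ 2 = (1 - x) * (1 + x) := by ring
  rw [h₃, show 1 - (r * 0 + x * 1) = 1 - x by ring, show 1 - (r * 0 + x * -1) = 1 + x by ring]
  field_simp
  ring

/-- the `C_{2v}(2R,2p)` branch of six-vortex relative equilibria
(Section 3.2.2, first family, aligned rings): the configuration is a relative
equilibrium about the `z`-axis iff `(y + x)(xy − 1 + 2λ_n(y − x)) = 0`. -/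
theorem C2v_2R2p_relative_equilibrium_iff (lamn x y : ℝ)
    (hx : x ∈ Set.Ioo (-1 : ℝ) 1) (hy : y ∈ Set.Ioo (-1 : ℝ) 1) (hxy : x ≠ y)
    (p : Fin 6 → R3) (lam : Fin 6 → ℝ)
    (hp : p = ![v3 (Real.sqrt (1 - x ^ 2)) 0 x, v3 (-Real.sqrt (1 - x ^ 2)) 0 x,
                v3 (Real.sqrt (1 - y ^ 2)) 0 y, v3 (-Real.sqrt (1 - y ^ 2)) 0 y,
                v3 0 0 1, v3 0 0 (-1)])
    (hlam : lam = ![1, 1, -1, -1, lamn, -lamn]) :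
    (∃ ξ : ℝ, ∀ i, vortexF lam p i = ξ • cross (v3 0 0 1) (p i)) ↔
      (y + x) * (x * y - 1 + 2 * lamn * (y - x)) = 0 := by
  obtain ⟨hx1, hx2⟩ := id hx
  obtain ⟨hy1, hy2⟩ := id hy
  have hX : 0 < 1 - x ^ 2 := by nlinarith
  have hY : 0 < 1 - y ^ 2 := by nlinarith
  have hr := Real.sq_sqrt hX.le
  have hs := Real.sq_sqrt hY.le
  have hr0 := (Real.sqrt_pos.mpr hX).ne'
  have hs0 := (Real.sqrt_pos.mpr hY).ne'
  generalize √(1 - x ^ 2) = r at *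
  generalize √(1 - y ^ 2) = s at *
  have hp' : p = fun i => v3 (![r, -r, s, -s, 0, 0] i) 0 (![x, x, y, y, 1, -1] i) := by
    rw [hp]; ext i; fin_cases i <;> rfl
  have scalar : (x / (1 - x ^ 2) + 2 / (x - y) + 2 * lamn / (1 - x ^ 2) =
      -(y / (1 - y ^ 2)) + 2 / (x - y) + 2 * lamn / (1 - y ^ 2)) ↔
      (y + x) * (x * y - 1 + 2 * lamn * (y - x)) = 0 := by
    rw [← sub_eq_zero]
    have : x / (1 - x ^ 2) + 2 / (x - y) + 2 * lamn / (1 - x ^ 2) -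
        (-(y / (1 - y ^ 2)) + 2 / (x - y) + 2 * lamn / (1 - y ^ 2)) =
        -((y + x) * (x * y - 1 + 2 * lamn * (y - x))) / ((1 - x ^ 2) * (1 - y ^ 2)) := by
      have := hX.ne'
      have := hY.ne'
      have := sub_ne_zero.mpr hxy
      field_simp
      ring
    rw [this, div_eq_zero_iff, neg_eq_zero, or_iff_left (mul_pos hX hY).ne']
  have A := antipode_contribution 1 r x hr hr0
  have B := ring_pair_contribution (-1) r s x y hr hs hxy
  have C := poles_contribution lamn r x hx
  have D := ring_pair_contribution 1 s r y x hs hr hxy.symm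
  have E := antipode_contribution (-1) s y hs hs0
  have G := poles_contribution lamn s y hy
  have hdiv : ∀ t : ℝ, 2 * t / (x - y) = 2 / (x - y) * t := fun t => by ring
  have hneg : 2 * r / (y - x) = -(2 / (x - y) * r) := by
    rw [← hdiv, ← neg_sub x y, div_neg]
  rw [hneg] at B
  rw [hdiv] at D
  rw [← scalar, hp', hlam]
  simp only [vortexF_meridian, smul_cross_axis_meridian, v3_axis_inj]
  have velocities : ∀ i, (∑ j ∈ Finset.univ.filter (fun j => j ≠ i),
      (![1, 1, -1, -1, lamn, -lamn] : Fin 6 → ℝ) j /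
        (1 - ((![r, -r, s, -s, 0, 0] : Fin 6 → ℝ) i * (![r, -r, s, -s, 0, 0] : Fin 6 → ℝ) j +
          (![x, x, y, y, 1, -1] : Fin 6 → ℝ) i * (![x, x, y, y, 1, -1] : Fin 6 → ℝ) j)) *
        ((![x, x, y, y, 1, -1] : Fin 6 → ℝ) j * (![r, -r, s, -s, 0, 0] : Fin 6 → ℝ) i -
          (![r, -r, s, -s, 0, 0] : Fin 6 → ℝ) j * (![x, x, y, y, 1, -1] : Fin 6 → ℝ) i)) =
      (![x / (1 - x ^ 2) + 2 / (x - y) + 2 * lamn / (1 - x ^ 2),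
        x / (1 - x ^ 2) + 2 / (x - y) + 2 * lamn / (1 - x ^ 2),
        -(y / (1 - y ^ 2)) + 2 / (x - y) + 2 * lamn / (1 - y ^ 2),
        -(y / (1 - y ^ 2)) + 2 / (x - y) + 2 * lamn / (1 - y ^ 2), 0, 0] : Fin 6 → ℝ) i *
        (![r, -r, s, -s, 0, 0] : Fin 6 → ℝ) i := by
    intro i
    rw [Finset.sum_filter]
    fin_cases i <;> simp [Fin.sum_univ_succ] <;> ring_nf at A B C D E G ⊢
    · linear_combination A + B + C
    · linear_combination -A - B - C
    · linear_combination D + E + G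
    · linear_combination -D - E - G
  simp only [velocities]
  constructor
  · rintro ⟨ξ, h⟩
    have h₁ := mul_right_cancel₀ hr0 (h 0)
    have h₂ := mul_right_cancel₀ hs0 (h 2)
    exact h₁.trans h₂.symm
  · intro h
    refine ⟨x / (1 - x ^ 2) + 2 / (x - y) + 2 * lamn / (1 - x ^ 2), fun i => ?_⟩
    fin_cases i <;> simp [h]
end
end

section
/- Eigenvalue lemma for the 4×4 blocks of the linearized vortex system (used in the proofs of Theorems 4.2–4.5): Let a, b, c ∈ ℝ and let M be the 4×4 real matrix whose rows are (0, 0, c, −b), (0, 0, a, −c), (−c, −b, 0, 0), (a, c, 0, 0). Then the characteristic polynomial of M is X⁴ + 2(ab + c²)·X² + (ab − c²)². If ab ≥ 0, the eigenvalues of M over ℂ are ±i(c + √(ab)) and ±i(c − √(ab)), all purely imaginary. Moreover, M (viewed as a complex matrix) has an eigenvalue with nonzero real part if and only if ab < 0. -/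
open Polynomial

/-- The characteristic polynomial of the block, from which its spectrum is read off. -/
theorem charpoly_block {R : Type*} [CommRing R] (a b c : R) :
    (!![0, 0, c, -b; 0, 0, a, -c; -c, -b, 0, 0; a, c, 0, 0] : Matrix (Fin 4) (Fin 4) R).charpoly =
      X ^ 4 + C (2 * (a * b + c ^ 2)) * X ^ 2 + C ((a * b - c ^ 2) ^ 2) := by
  simp [Matrix.charpoly, Matrix.charmatrix, Matrix.det_succ_row_zero, Fin.sum_univ_succ,
    Fin.succAbove, map_ofNat C 2]
  ring

/-- If `s ^ 2 = a * b`, the block has the eigenvalues `±i(c + s)`, `±i(c - s)`. -/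
theorem mem_spectrum_block_iff {a b c s : ℂ} (hs : s ^ 2 = a * b) (z : ℂ) :
    z ∈ spectrum ℂ
        (!![0, 0, c, -b; 0, 0, a, -c; -c, -b, 0, 0; a, c, 0, 0] : Matrix (Fin 4) (Fin 4) ℂ) ↔
      z = Complex.I * (c + s) ∨ z = -(Complex.I * (c + s)) ∨
        z = Complex.I * (c - s) ∨ z = -(Complex.I * (c - s)) := by
  have hfactor : z ^ 4 + 2 * (a * b + c ^ 2) * z ^ 2 + (a * b - c ^ 2) ^ 2 =
      (z - Complex.I * (c + s)) * ((z + Complex.I * (c + s)) *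
        ((z - Complex.I * (c - s)) * (z + Complex.I * (c - s)))) := by
    rw [← hs]
    linear_combination (z ^ 2 * ((c + s) ^ 2 + (c - s) ^ 2) -
      (Complex.I ^ 2 - 1) * (c + s) ^ 2 * (c - s) ^ 2) * Complex.I_sq
  rw [Matrix.mem_spectrum_iff_isRoot_charpoly, charpoly_block, IsRoot.def]
  simp only [eval_add, eval_mul, eval_pow, eval_X, eval_C]
  rw [hfactor]
  simp only [mul_eq_zero, sub_eq_zero, add_eq_zero_iff_eq_neg]

/-- eigenvalue lemma for the `4×4` blocks of the linearized vortex system: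
the characteristic polynomial is `X⁴ + 2(ab + c²)X² + (ab − c²)²`; if `ab ≥ 0` the complex
eigenvalues are `±i(c + √(ab))`, `±i(c − √(ab))`, all purely imaginary; and there is an
eigenvalue with nonzero real part iff `ab < 0`. -/
theorem block_eigenvalues (a b c : ℝ) (M : Matrix (Fin 4) (Fin 4) ℝ)
    (hM : M = !![0, 0, c, -b; 0, 0, a, -c; -c, -b, 0, 0; a, c, 0, 0]) :
    M.charpoly = X ^ 4 + C (2 * (a * b + c ^ 2)) * X ^ 2 + C ((a * b - c ^ 2) ^ 2) ∧
    (0 ≤ a * b →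
      spectrum ℂ (M.map (algebraMap ℝ ℂ)) =
        {Complex.I * ((c + Real.sqrt (a * b) : ℝ) : ℂ),
         -(Complex.I * ((c + Real.sqrt (a * b) : ℝ) : ℂ)),
         Complex.I * ((c - Real.sqrt (a * b) : ℝ) : ℂ),
         -(Complex.I * ((c - Real.sqrt (a * b) : ℝ) : ℂ))} ∧
      ∀ μ ∈ spectrum ℂ (M.map (algebraMap ℝ ℂ)), μ.re = 0) ∧
    ((∃ μ ∈ spectrum ℂ (M.map (algebraMap ℝ ℂ)), μ.re ≠ 0) ↔ a * b < 0) := by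
  have hmap : M.map (algebraMap ℝ ℂ) =
      !![0, 0, (c : ℂ), -(b : ℂ); 0, 0, (a : ℂ), -(c : ℂ);
        -(c : ℂ), -(b : ℂ), 0, 0; (a : ℂ), (c : ℂ), 0, 0] := by
    subst hM
    ext i j
    fin_cases i <;> fin_cases j <;> simp
  have hspec (h : 0 ≤ a * b) : spectrum ℂ (M.map (algebraMap ℝ ℂ)) =
      {Complex.I * ((c + Real.sqrt (a * b) : ℝ) : ℂ),
       -(Complex.I * ((c + Real.sqrt (a * b) : ℝ) : ℂ)),
       Complex.I * ((c - Real.sqrt (a * b) : ℝ) : ℂ),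
       -(Complex.I * ((c - Real.sqrt (a * b) : ℝ) : ℂ))} := by
    have hs : ((Real.sqrt (a * b) : ℝ) : ℂ) ^ 2 = (a : ℂ) * b := by
      exact_mod_cast Real.sq_sqrt h
    ext z
    rw [hmap, mem_spectrum_block_iff hs]
    simp only [Set.mem_insert_iff, Set.mem_singleton_iff, Complex.ofReal_add, Complex.ofReal_sub]
  have him (h : 0 ≤ a * b) : ∀ z ∈ spectrum ℂ (M.map (algebraMap ℝ ℂ)), z.re = 0 := by
    intro z hz
    rw [hspec h] at hz
    rcases hz with rfl | rfl | rfl | rfl <;> simp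
  refine ⟨hM ▸ charpoly_block a b c, fun h => ⟨hspec h, him h⟩, ?_, fun h => ?_⟩
  · rintro ⟨z, hz, hre⟩
    by_contra! h
    exact hre (him h z hz)
  · have hs : (Complex.I * (Real.sqrt (-(a * b)) : ℝ)) ^ 2 = (a : ℂ) * b := by
      rw [mul_pow, Complex.I_sq, ← Complex.ofReal_pow, Real.sq_sqrt (by linarith)]
      push_cast
      ring
    refine ⟨_, hmap ▸ (mem_spectrum_block_iff hs _).2 (Or.inl rfl), ?_⟩
    simpa using (Real.sqrt_pos.2 (neg_pos.2 h)).ne'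
end
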